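/- Let n ≥ 1, H a complex Hilbert space, Y a complex Banach space, and U : B(H) → Y a nonzero bounded linear operator with ‖U‖ < λ, where λ > 1, 1 ≤ p < ∞ and 1 ≤ q ≤ ∞. Set D := max{ (1/(4λ·2^{1/p}))·((λ^p − ‖U‖^p)/(2λ^p − ‖U‖^p))^{1/p}, (1/(4λ·2^{1/p}))·((λ^p − ‖U‖^p)/(λ^p − ‖U‖^p + 1))^{1/p}·(1/‖U‖) } if ‖U‖ ≥ 1/(4λ·2^{1/p}), and D := max{ (1/(4λ·2^{1/p}))·((λ^p − ‖U‖^p)/(2λ^p − ‖U‖^p))^{1/p}, (1/(4λ·2^{1/p}))·((λ^p − ‖U‖^p)/(λ^p − ‖U‖^p + 1))^{1/p} } if 0 < ‖U‖ < 1/(4λ·2^{1/p}). Then L_λ(B_{ℓⁿ_q},p,U) ≥ D · n^{−(1/p + 1/q)} (with 1/q := 0 when q = ∞). -/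

import Mathlib

open scoped ENNReal Pointwise
open Filter

noncomputable section

namespace BohrPaper

/-- The monomial `z^α = z₁^{α₁} ⋯ z_n^{α_n}`. -/
def mpow {n : ℕ} (z : Fin n → ℂ) (α : Fin n → ℕ) : ℂ := ∏ j, z j ^ α j

/-- A complete Reinhardt domain in `ℂⁿ`: nonempty, open, connected and closed under
componentwise decrease of moduli. -/
def IsCompleteReinhardt {n : ℕ} (Ω : Set (Fin n → ℂ)) : Prop :=
  IsOpen Ω ∧ IsConnected Ω ∧
    ∀ z ∈ Ω, ∀ w : Fin n → ℂ, (∀ j, ‖w j‖ ≤ ‖z j‖) → w ∈ Ω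

/-- `S(Ω₁, Ω₂) := inf {s > 0 : Ω₁ ⊆ s·Ω₂}`. -/
def SRatio {n : ℕ} (Ω₁ Ω₂ : Set (Fin n → ℂ)) : ℝ :=
  sInf {s : ℝ | 0 < s ∧ Ω₁ ⊆ s • Ω₂}

/-- The open unit polydisc `𝔻ⁿ`. -/
def polydisc (n : ℕ) : Set (Fin n → ℂ) := {z | ∀ j, ‖z j‖ < 1}

/-- The sup-norm of `f` over `Ω`. -/
def supNorm {n : ℕ} {E : Type*} [Norm E] (Ω : Set (Fin n → ℂ)) (f : (Fin n → ℂ) → E) : ℝ :=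
  ⨆ z ∈ Ω, ‖f z‖

/-- The `ℓ_q`-norm on `ℂⁿ` (`q = ∞` gives the max norm). -/
def lqNorm (n : ℕ) (q : ℝ≥0∞) (z : Fin n → ℂ) : ℝ :=
  if q = ∞ then ⨆ j, ‖z j‖
  else (∑ j, ‖z j‖ ^ q.toReal) ^ (1 / q.toReal)

/-- The open unit ball of `ℓⁿ_q`. -/
def lqBall (n : ℕ) (q : ℝ≥0∞) : Set (Fin n → ℂ) := {z | lqNorm n q z < 1}

/-- `N` is a norm on `ℂⁿ`. -/
def IsNorm {n : ℕ} (N : (Fin n → ℂ) → ℝ) : Prop :=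
  (∀ z, 0 ≤ N z) ∧ (∀ z, N z = 0 → z = 0) ∧
    (∀ (c : ℂ) (z), N (c • z) = ‖c‖ * N z) ∧ ∀ z w, N (z + w) ≤ N z + N w

/-- The canonical basis of `ℂⁿ` is normalized and 1-unconditional for the norm `N`. -/
def IsNormalized1Unconditional {n : ℕ} (N : (Fin n → ℂ) → ℝ) : Prop :=
  (∀ k, N (fun j => if j = k then 1 else 0) = 1) ∧
    ∀ ε μ : Fin n → ℂ, (∀ j, ‖ε j‖ ≤ 1) → N (fun j => ε j * μ j) ≤ N μ

/-- Open unit ball of the norm `N`. -/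
def unitBall {n : ℕ} (N : (Fin n → ℂ) → ℝ) : Set (Fin n → ℂ) := {z | N z < 1}

/-- Operator norm of the identity map `(ℂⁿ, N₁) → (ℂⁿ, N₂)`. -/
def idNorm {n : ℕ} (N₁ N₂ : (Fin n → ℂ) → ℝ) : ℝ :=
  sInf {c : ℝ | 0 ≤ c ∧ ∀ z, N₂ z ≤ c * N₁ z}

/-- `b_m(Ω) = (inf_{|α| = m} sup_{z ∈ Ω} |z^α|)^{-1/m}`. -/
def bCoef {n : ℕ} (Ω : Set (Fin n → ℂ)) (m : ℕ) : ℝ :=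
  (sInf ((fun α : Fin n → ℕ => ⨆ z ∈ Ω, ‖mpow z α‖) ''
      {α : Fin n → ℕ | ∑ j, α j = m})) ^ (-(1 / (m : ℝ)))

section Pluriharmonic

variable {n : ℕ} {H : Type*} [NormedAddCommGroup H] [InnerProductSpace ℂ H] [CompleteSpace H]
  {Y : Type*} [NormedAddCommGroup Y] [NormedSpace ℂ Y]

/-- `f` is a bounded pluriharmonic `B(H)`-valued function on `Ω`, given by coefficient
families `a`, `b` (with `b 0 = 0`): `f = Σ a_α z^α + Σ (b_α)* z̄^α`, both power series
converging locally uniformly on `Ω`, and `f` bounded on `Ω`. -/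
def IsBddPluriharmonic (Ω : Set (Fin n → ℂ)) (f : (Fin n → ℂ) → H →L[ℂ] H)
    (a b : (Fin n → ℕ) → H →L[ℂ] H) : Prop :=
  b 0 = 0 ∧
    (∃ h g : (Fin n → ℂ) → H →L[ℂ] H,
      TendstoLocallyUniformlyOn
        (fun (s : Finset (Fin n → ℕ)) z => ∑ α ∈ s, mpow z α • a α) h atTop Ω ∧
      TendstoLocallyUniformlyOn
        (fun (s : Finset (Fin n → ℕ)) z =>
          ∑ α ∈ s, mpow (star z) α • ContinuousLinearMap.adjoint (b α)) g atTop Ω ∧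
      ∀ z ∈ Ω, f z = h z + g z) ∧
    BddAbove ((fun z => ‖f z‖) '' Ω)

/-- The left-hand side `Σ_α sup_{z ∈ rΩ} (‖U a_α‖^p + ‖U b_α‖^p)|z^α|^p` of the second
Bohr inequality for pluriharmonic functions, valued in `ℝ≥0∞`. -/
def phBohrSum (Ω : Set (Fin n → ℂ)) (r p : ℝ) (U : (H →L[ℂ] H) →L[ℂ] Y)
    (a b : (Fin n → ℕ) → H →L[ℂ] H) : ℝ≥0∞ :=
  ∑' α : Fin n → ℕ, ⨆ z ∈ r • Ω,
    ENNReal.ofReal ((‖U (a α)‖ ^ p + ‖U (b α)‖ ^ p) * ‖mpow z α‖ ^ p)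

/-- The second `λ`-powered Bohr radius `L_λ(Ω, p, U)` for pluriharmonic functions. -/
def secondBohrPH (Ω : Set (Fin n → ℂ)) (p lam : ℝ) (U : (H →L[ℂ] H) →L[ℂ] Y) : ℝ :=
  sSup {r : ℝ | r ∈ Set.Icc (0 : ℝ) 1 ∧
    ∀ (f : (Fin n → ℂ) → H →L[ℂ] H) (a b : (Fin n → ℕ) → H →L[ℂ] H),
      IsBddPluriharmonic Ω f a b →
      phBohrSum Ω r p U a b ≤ ENNReal.ofReal (lam ^ p * supNorm Ω f ^ p)}

end Pluriharmonic

section Torus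

open MeasureTheory AddCircle

/-- The normalized Haar measure on the torus `(ℝ/ℤ)ⁿ`. -/
def torusMeasure (n : ℕ) : Measure (Fin n → AddCircle (1 : ℝ)) :=
  Measure.pi fun _ => haarAddCircle

instance (n : ℕ) : IsProbabilityMeasure (torusMeasure n) := by
  unfold torusMeasure; infer_instance

/-- The character of the torus with frequency vector `k`. -/
def torusChar {n : ℕ} (k : Fin n → ℤ) (t : Fin n → AddCircle (1 : ℝ)) : ℂ :=
  ∏ j, fourier (k j) (t j)

variable {n : ℕ}

lemma continuous_torusChar (k : Fin n → ℤ) : Continuous (torusChar k) := by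
  unfold torusChar; fun_prop

lemma norm_torusChar (k : Fin n → ℤ) (t : Fin n → AddCircle (1 : ℝ)) :
    ‖torusChar k t‖ = 1 := by
  simp only [torusChar, norm_prod, fourier_apply, Circle.norm_coe, Finset.prod_const_one]

lemma torusChar_add (k l : Fin n → ℤ) (t : Fin n → AddCircle (1 : ℝ)) :
    torusChar (k + l) t = torusChar k t * torusChar l t := by
  simp only [torusChar, Pi.add_apply, fourier_add, Finset.prod_mul_distrib]

lemma integral_fourier (m : ℤ) :
    ∫ x : AddCircle (1 : ℝ), (fourier m x : ℂ) ∂haarAddCircle = if m = 0 then 1 else 0 := by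
  split_ifs with h
  · simp [h]
  · exact integral_eq_zero_of_add_right_eq_neg (μ := haarAddCircle)
      (fourier_add_half_inv_index h zero_lt_one)

lemma integral_torusChar (k : Fin n → ℤ) :
    ∫ t, torusChar k t ∂torusMeasure n = if k = 0 then 1 else 0 := by
  unfold torusChar torusMeasure
  rw [integral_fintype_prod_eq_prod (fun j (x : AddCircle (1 : ℝ)) => (fourier (k j) x : ℂ))]
  simp_rw [integral_fourier]
  split_ifs with h
  · simp [h]
  · obtain ⟨i, hi⟩ := Function.ne_iff.mp h
    exact Finset.prod_eq_zero (Finset.mem_univ i) (if_neg hi)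

/-- The coefficients of a trigonometric polynomial are bounded by its supremum. -/
lemma norm_sum_filter_le_of_forall_norm_le {ι E : Type*} [NormedAddCommGroup E]
    [NormedSpace ℂ E] [CompleteSpace E] (s : Finset ι) (k : ι → Fin n → ℤ) (c : ι → E) {M : ℝ}
    (hM : ∀ t, ‖∑ i ∈ s, torusChar (k i) t • c i‖ ≤ M) (l : Fin n → ℤ) :
    ‖∑ i ∈ s with k i = l, c i‖ ≤ M := by
  have hint : ∫ t, torusChar (-l) t • ∑ i ∈ s, torusChar (k i) t • c i ∂torusMeasure n
      = ∑ i ∈ s with k i = l, c i := by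
    simp_rw [Finset.smul_sum, smul_smul, ← torusChar_add]
    rw [integral_finsetSum]
    · simp_rw [integral_smul_const, integral_torusChar, Finset.sum_filter]
      refine Finset.sum_congr rfl fun i _ => ?_
      have : (-l + k i = 0) ↔ k i = l := by rw [neg_add_eq_zero, eq_comm]
      simp [this]
    · intro i _
      refine Integrable.smul_const ?_ _
      exact Integrable.of_bound (continuous_torusChar _).aestronglyMeasurable 1
        (Eventually.of_forall fun t => (norm_torusChar _ t).le)
  rw [← hint]
  refine (norm_integral_le_of_norm_le_const (C := M) (Eventually.of_forall fun t => ?_)).trans ?_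
  · rw [norm_smul, norm_torusChar, one_mul]; exact hM t
  · simp

/-- The point obtained from `z` by rotating its coordinates by the angles `t`. -/
def rotate (z : Fin n → ℂ) (t : Fin n → AddCircle (1 : ℝ)) : Fin n → ℂ :=
  fun j => fourier 1 (t j) * z j

lemma continuous_rotate (z : Fin n → ℂ) : Continuous (rotate z) := by
  unfold rotate; fun_prop

lemma norm_rotate (z : Fin n → ℂ) (t : Fin n → AddCircle (1 : ℝ)) (j : Fin n) :
    ‖rotate z t j‖ = ‖z j‖ := by
  simp only [rotate, norm_mul, fourier_apply, Circle.norm_coe, one_mul]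

lemma fourier_natCast (m : ℕ) (x : AddCircle (1 : ℝ)) :
    (fourier (m : ℤ) x : ℂ) = fourier 1 x ^ m := by
  induction m with
  | zero => simp
  | succ m ih => rw [Nat.cast_succ, fourier_add, ih, pow_succ]

lemma mpow_rotate (z : Fin n → ℂ) (t : Fin n → AddCircle (1 : ℝ)) (α : Fin n → ℕ) :
    mpow (rotate z t) α = torusChar (fun j => (α j : ℤ)) t * mpow z α := by
  simp only [mpow, rotate, torusChar, mul_pow, Finset.prod_mul_distrib, fourier_natCast]

lemma mpow_star (z : Fin n → ℂ) (α : Fin n → ℕ) : mpow (star z) α = star (mpow z α) := by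
  simp [mpow]

lemma star_torusChar (k : Fin n → ℤ) (t : Fin n → AddCircle (1 : ℝ)) :
    star (torusChar k t) = torusChar (-k) t := by
  simp only [torusChar, Pi.neg_apply, fourier_neg, map_prod, ← starRingEnd_apply]

end Torus

section Coefficients

variable {n : ℕ} {H : Type*} [NormedAddCommGroup H] [InnerProductSpace ℂ H] [CompleteSpace H]

lemma norm_le_supNorm {E : Type*} [NormedAddCommGroup E] {Ω : Set (Fin n → ℂ)}
    {f : (Fin n → ℂ) → E} (hf : BddAbove ((fun z => ‖f z‖) '' Ω)) {z : Fin n → ℂ} (hz : z ∈ Ω) :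
    ‖f z‖ ≤ supNorm Ω f := by
  obtain ⟨C, hC⟩ := hf
  have hbdd : BddAbove (Set.range fun z => ⨆ _ : z ∈ Ω, ‖f z‖) := by
    refine ⟨max C 0, ?_⟩
    rintro _ ⟨w, rfl⟩
    exact Real.iSup_le (fun hw => (hC ⟨w, hw, rfl⟩).trans (le_max_left _ _)) (le_max_right _ _)
  refine le_trans ?_ (le_ciSup hbdd z)
  simp [hz]

/-- Cauchy estimates for the coefficients of a bounded pluriharmonic function. -/
lemma IsBddPluriharmonic.norm_coeff_le {Ω : Set (Fin n → ℂ)}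
    {f : (Fin n → ℂ) → H →L[ℂ] H} {a b : (Fin n → ℕ) → H →L[ℂ] H}
    (hf : IsBddPluriharmonic Ω f a b) {z : Fin n → ℂ} (hz : ∀ t, rotate z t ∈ Ω)
    (α : Fin n → ℕ) :
    ‖mpow z α‖ * ‖a α‖ ≤ supNorm Ω f ∧ ‖mpow z α‖ * ‖b α‖ ≤ supNorm Ω f := by
  obtain ⟨hb0, ⟨h, g, hh, hg, hfg⟩, hbdd⟩ := hf
  set K := Set.range (rotate z)
  have hK : IsCompact K := isCompact_range (continuous_rotate z)
  have hKΩ : K ⊆ Ω := by rintro _ ⟨t, rfl⟩; exact hz t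
  have hh' := (tendstoLocallyUniformlyOn_iff_tendstoUniformlyOn_of_compact hK).1 (hh.mono hKΩ)
  have hg' := (tendstoLocallyUniformlyOn_iff_tendstoUniformlyOn_of_compact hK).1 (hg.mono hKΩ)
  have key : ∀ ε > 0, ‖mpow z α‖ * ‖a α‖ ≤ supNorm Ω f + ε ∧
      ‖mpow z α‖ * ‖b α‖ ≤ supNorm Ω f + ε := by
    intro ε hε
    have e1 := Metric.tendstoUniformlyOn_iff.1 hh' (ε / 2) (half_pos hε)
    have e2 := Metric.tendstoUniformlyOn_iff.1 hg' (ε / 2) (half_pos hε)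
    obtain ⟨s, ⟨hs1, hs2⟩, hαs⟩ := ((e1.and e2).and (eventually_ge_atTop {α})).exists
    replace hαs : α ∈ s := by simpa using hαs
    let k : (Fin n → ℕ) ⊕ (Fin n → ℕ) → Fin n → ℤ :=
      Sum.elim (fun β j => (β j : ℤ)) (fun β j => -(β j : ℤ))
    let c : (Fin n → ℕ) ⊕ (Fin n → ℕ) → H →L[ℂ] H :=
      Sum.elim (fun β => mpow z β • a β)
        (fun β => star (mpow z β) • ContinuousLinearMap.adjoint (b β))
    have hM : ∀ t, ‖∑ i ∈ s.disjSum s, torusChar (k i) t • c i‖ ≤ supNorm Ω f + ε := by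
      intro t
      have h1 := hs1 (rotate z t) ⟨t, rfl⟩
      have h2 := hs2 (rotate z t) ⟨t, rfl⟩
      have h3 := norm_le_supNorm hbdd (hz t)
      rw [hfg _ (hz t)] at h3
      have hsum : ∑ i ∈ s.disjSum s, torusChar (k i) t • c i
          = ∑ β ∈ s, mpow (rotate z t) β • a β +
            ∑ β ∈ s, mpow (star (rotate z t)) β • ContinuousLinearMap.adjoint (b β) := by
        rw [Finset.sum_disjSum]
        congr 1
        · refine Finset.sum_congr rfl fun β _ => ?_
          simp only [k, c, Sum.elim_inl, mpow_rotate, smul_smul]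
        · refine Finset.sum_congr rfl fun β _ => ?_
          simp only [k, c, Sum.elim_inr, mpow_star, mpow_rotate, smul_smul, star_mul',
            star_torusChar]
          rfl
      rw [hsum]
      rw [dist_eq_norm, norm_sub_rev] at h1 h2
      set P := ∑ β ∈ s, mpow (rotate z t) β • a β
      set Q := ∑ β ∈ s, mpow (star (rotate z t)) β • ContinuousLinearMap.adjoint (b β)
      have : P + Q = (h (rotate z t) + g (rotate z t)) + ((P - h (rotate z t)) +
          (Q - g (rotate z t))) := by abel
      rw [this]
      refine (norm_add_le _ _).trans (add_le_add h3 ((norm_add_le _ _).trans ?_))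
      linarith
    constructor
    · have := norm_sum_filter_le_of_forall_norm_le _ k c hM (fun j => (α j : ℤ))
      rw [Finset.sum_filter, Finset.sum_disjSum] at this
      have z1 : ∑ β ∈ s, (if k (Sum.inl β) = fun j => (α j : ℤ) then c (Sum.inl β) else 0)
          = mpow z α • a α := by
        rw [Finset.sum_eq_single_of_mem α hαs]
        · simp [k, c]
        · intro β _ hβ
          refine if_neg fun hk => hβ (funext fun j => ?_)
          simpa [k] using congrFun hk j
      have z2 : ∑ β ∈ s, (if k (Sum.inr β) = fun j => (α j : ℤ) then c (Sum.inr β) else 0)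
          = 0 := by
        refine Finset.sum_eq_zero fun β _ => ?_
        split_ifs with hk
        · have : β = 0 := funext fun j => by
            have := congrFun hk j
            simp only [k, Sum.elim_inr] at this
            simp only [Pi.zero_apply]; omega
          simp [c, this, hb0]
        · rfl
      rwa [z1, z2, add_zero, norm_smul] at this
    · by_cases hα : α = 0
      · subst hα
        rw [hb0]
        have := (norm_nonneg _).trans (hM 0)
        simpa using this
      have := norm_sum_filter_le_of_forall_norm_le _ k c hM (fun j => -(α j : ℤ))
      rw [Finset.sum_filter, Finset.sum_disjSum] at this
      have z1 : ∑ β ∈ s, (if k (Sum.inl β) = fun j => -(α j : ℤ) then c (Sum.inl β) else 0)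
          = 0 := by
        refine Finset.sum_eq_zero fun β _ => if_neg fun hk => hα (funext fun j => ?_)
        have := congrFun hk j
        simp only [k, Sum.elim_inl] at this
        simp only [Pi.zero_apply]; omega
      have z2 : ∑ β ∈ s, (if k (Sum.inr β) = fun j => -(α j : ℤ) then c (Sum.inr β) else 0)
          = star (mpow z α) • ContinuousLinearMap.adjoint (b α) := by
        rw [Finset.sum_eq_single_of_mem α hαs]
        · simp [k, c]
        · intro β _ hβ
          refine if_neg fun hk => hβ (funext fun j => ?_)
          simpa [k] using congrFun hk j
      rwa [z1, z2, zero_add, norm_smul, norm_star, LinearIsometryEquiv.norm_map] at this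
  exact ⟨le_of_forall_pos_le_add fun ε hε => (key ε hε).1,
    le_of_forall_pos_le_add fun ε hε => (key ε hε).2⟩

end Coefficients

section Sums

variable {n : ℕ}

lemma sum_piFinset_pow_le {y : ℝ} (hy0 : 0 ≤ y) (hy : n * y < 1) (hy1 : y < 1) (N : ℕ) :
    ∑ α ∈ Fintype.piFinset (fun _ : Fin n => Finset.range N), y ^ ∑ j, α j ≤ (1 - n * y)⁻¹ := by
  simp_rw [← Finset.prod_pow_eq_pow_sum]
  rw [Finset.sum_prod_piFinset (Finset.range N) (fun _ i => y ^ i)]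
  rw [Finset.prod_const, Finset.card_univ, Fintype.card_fin]
  have h1 : ∑ i ∈ Finset.range N, y ^ i ≤ (1 - y)⁻¹ := by
    rw [← tsum_geometric_of_lt_one hy0 hy1]
    exact (summable_geometric_of_lt_one hy0 hy1).sum_le_tsum _ fun i _ => pow_nonneg hy0 i
  refine (pow_le_pow_left₀ (Finset.sum_nonneg fun i _ => pow_nonneg hy0 i) h1 n).trans ?_
  rw [inv_pow]
  refine inv_anti₀ (by linarith) ?_
  have := one_add_mul_le_pow (a := -y) (by linarith) n
  calc 1 - n * y = 1 + n * (-y) := by ring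
    _ ≤ (1 + -y) ^ n := this
    _ = (1 - y) ^ n := by ring

/-- Summing a family over `ℕⁿ` that is dominated, off the origin, by a geometric one. -/
lemma tsum_le_of_le_geometric {F : (Fin n → ℕ) → ℝ≥0∞} {c y : ℝ} (hc : 0 ≤ c) (hy0 : 0 ≤ y)
    (hy : n * y < 1) (hy1 : y < 1) (h0 : F 0 ≤ ENNReal.ofReal c)
    (hF : ∀ α, F α ≤ ENNReal.ofReal (2 * c * y ^ ∑ j, α j)) :
    ∑' α, F α ≤ ENNReal.ofReal (2 * c * (1 - n * y)⁻¹ - c) := by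
  rw [ENNReal.tsum_eq_iSup_sum]
  refine iSup_le fun s => ?_
  obtain ⟨N, hN0, hN⟩ : ∃ N, 0 < N ∧
      s ⊆ Fintype.piFinset (fun _ : Fin n => Finset.range N) := by
    refine ⟨s.sup (fun α => ∑ j, α j) + 1, Nat.succ_pos _, fun α hα => ?_⟩
    rw [Fintype.mem_piFinset]
    intro j
    rw [Finset.mem_range, Nat.lt_succ_iff]
    exact (Finset.single_le_sum (f := α) (fun _ _ => Nat.zero_le _) (Finset.mem_univ j)).trans
      (Finset.le_sup (f := fun α : Fin n → ℕ => ∑ j, α j) hα)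
  set t := Fintype.piFinset (fun _ : Fin n => Finset.range N)
  have h0t : (0 : Fin n → ℕ) ∈ t := by simp [t, hN0]
  refine (Finset.sum_le_sum_of_subset hN).trans ?_
  have hle : ∀ α ∈ t, F α ≤ ENNReal.ofReal (2 * c * y ^ ∑ j, α j - if α = 0 then c else 0) := by
    intro α _
    split_ifs with hα
    · subst hα
      refine h0.trans (ENNReal.ofReal_le_ofReal ?_)
      simp; linarith
    · simpa using hF α
  refine (Finset.sum_le_sum hle).trans ?_
  rw [← ENNReal.ofReal_sum_of_nonneg]
  · refine ENNReal.ofReal_le_ofReal ?_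
    rw [Finset.sum_sub_distrib, Finset.sum_ite_eq' t, if_pos h0t, ← Finset.mul_sum]
    gcongr
    exact sum_piFinset_pow_le hy0 hy hy1 N
  · intro α _
    split_ifs with hα
    · subst hα; simp; linarith
    · have := pow_nonneg hy0 (∑ j, α j)
      rw [sub_zero]; positivity

end Sums

lemma mpow_smul {n : ℕ} (r : ℝ) (z : Fin n → ℂ) (α : Fin n → ℕ) :
    mpow (r • z) α = (r : ℂ) ^ (∑ j, α j) * mpow z α := by
  simp [mpow, mul_pow, Finset.prod_mul_distrib, Finset.prod_pow_eq_pow_sum]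

/-- A radius `r` with `n r^p (λ^p + ‖U‖^p) ≤ λ^p - ‖U‖^p` is admissible for the second Bohr
inequality on every domain invariant under rotations of the coordinates. -/
lemma le_secondBohrPH {n : ℕ} (hn : 1 ≤ n)
    {H : Type*} [NormedAddCommGroup H] [InnerProductSpace ℂ H] [CompleteSpace H]
    {Y : Type*} [NormedAddCommGroup Y] [NormedSpace ℂ Y]
    (U : (H →L[ℂ] H) →L[ℂ] Y) {p lam r : ℝ} {Ω : Set (Fin n → ℂ)}
    (hΩ : ∀ z ∈ Ω, ∀ t, rotate z t ∈ Ω) (hp : 1 ≤ p) (hlam : 0 ≤ lam) (hU0 : U ≠ 0)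
    (hr0 : 0 ≤ r) (hr : n * r ^ p * (lam ^ p + ‖U‖ ^ p) ≤ lam ^ p - ‖U‖ ^ p) :
    r ≤ secondBohrPH Ω p lam U := by
  have hp0 : 0 < p := by linarith
  have hu : 0 < ‖U‖ ^ p := Real.rpow_pos_of_pos (norm_pos_iff.2 hU0) p
  have hA : 0 ≤ lam ^ p := Real.rpow_nonneg hlam p
  set y := r ^ p with hy
  have hy0 : 0 ≤ y := Real.rpow_nonneg hr0 p
  have hny : n * y < 1 := by
    by_contra! h
    nlinarith
  have hn' : (1 : ℝ) ≤ n := by exact_mod_cast hn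
  have hy1 : y < 1 := by nlinarith
  have hr1 : r ≤ 1 := by
    by_contra! h
    have := Real.one_lt_rpow h hp0
    linarith
  refine le_csSup ⟨1, fun x hx => hx.1.2⟩ ⟨⟨hr0, hr1⟩, fun f a b hf => ?_⟩
  set M := supNorm Ω f
  have hM : 0 ≤ M := Real.iSup_nonneg fun z => Real.iSup_nonneg fun _ => norm_nonneg _
  have hcoef : ∀ (α : Fin n → ℕ) (w : Fin n → ℂ) (x : H →L[ℂ] H), ‖mpow w α‖ * ‖x‖ ≤ M →
      ‖U x‖ ^ p * ‖mpow w α‖ ^ p ≤ ‖U‖ ^ p * M ^ p := by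
    intro α w x hx
    rw [← Real.mul_rpow (norm_nonneg _) (norm_nonneg _), ← Real.mul_rpow (norm_nonneg _) hM]
    refine Real.rpow_le_rpow (by positivity) ?_ hp0.le
    calc ‖U x‖ * ‖mpow w α‖ ≤ ‖U‖ * ‖x‖ * ‖mpow w α‖ := by gcongr; exact U.le_opNorm x
      _ = ‖U‖ * (‖mpow w α‖ * ‖x‖) := by ring
      _ ≤ ‖U‖ * M := by gcongr
  have hsum : phBohrSum Ω r p U a b
      ≤ ENNReal.ofReal (2 * (‖U‖ ^ p * M ^ p) * (1 - n * y)⁻¹ - ‖U‖ ^ p * M ^ p) := by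
    refine tsum_le_of_le_geometric (by positivity) hy0 hny hy1 ?_ fun α => ?_
    · refine iSup₂_le fun z hz => ENNReal.ofReal_le_ofReal ?_
      obtain ⟨w, hw, rfl⟩ := Set.mem_smul_set.1 hz
      have h := hcoef 0 w (a 0) (hf.norm_coeff_le (hΩ w hw) 0).1
      simpa [hf.1, hp0.ne', mpow] using h
    · refine iSup₂_le fun z hz => ENNReal.ofReal_le_ofReal ?_
      obtain ⟨w, hw, rfl⟩ := Set.mem_smul_set.1 hz
      have h1 := hcoef α w (a α) (hf.norm_coeff_le (hΩ w hw) α).1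
      have h2 := hcoef α w (b α) (hf.norm_coeff_le (hΩ w hw) α).2
      have h3 : ‖mpow (r • w) α‖ ^ p = y ^ (∑ j, α j) * ‖mpow w α‖ ^ p := by
        rw [mpow_smul, norm_mul, norm_pow, Complex.norm_real, Real.norm_of_nonneg hr0,
          Real.mul_rpow (by positivity) (norm_nonneg _), hy, Real.rpow_pow_comm hr0]
      have h4 : 0 ≤ y ^ (∑ j, α j) := pow_nonneg hy0 _
      rw [h3]
      nlinarith
  refine hsum.trans (ENNReal.ofReal_le_ofReal ?_)
  have hMp : 0 ≤ M ^ p := Real.rpow_nonneg hM p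
  have hpos : 0 < 1 - n * y := by linarith
  have : 2 * ‖U‖ ^ p * (1 - n * y)⁻¹ ≤ lam ^ p + ‖U‖ ^ p := by
    rw [← div_eq_mul_inv, div_le_iff₀ hpos]
    linarith
  nlinarith

lemma rotate_mem_lqBall {n : ℕ} {q : ℝ≥0∞} {z : Fin n → ℂ} (hz : z ∈ lqBall n q)
    (t : Fin n → AddCircle (1 : ℝ)) : rotate z t ∈ lqBall n q := by
  simpa only [lqBall, lqNorm, Set.mem_ofPred_eq, norm_rotate] using hz

/-- The elementary estimates behind the explicit value of the constant. -/
lemma bohr_const_estimates {A u B : ℝ} (hA : 1 ≤ A) (hu0 : 0 < u) (huA : u < A) (hB : 2 ≤ B) :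
    1 / (A * B) * ((A - u) / (2 * A - u)) * (A + u) ≤ A - u ∧
    1 / (A * B) * ((A - u) / (A - u + 1)) * (A + u) ≤ A - u ∧
    (1 / (A * B) ≤ u → 1 / (A * B) * ((A - u) / (A - u + 1)) * (1 / u) * (A + u) ≤ A - u) := by
  have hAB : 2 * A ≤ A * B := by nlinarith
  have hAB0 : 0 < A * B := by nlinarith
  have hd : 0 < A - u := by linarith
  refine ⟨?_, ?_, fun h => ?_⟩
  · have e : 1 / (A * B) * ((A - u) / (2 * A - u)) * (A + u)
        = (A - u) * ((A + u) / (A * B * (2 * A - u))) := by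
      have : 2 * A - u ≠ 0 := by linarith
      field_simp
    rw [e]
    refine mul_le_of_le_one_right hd.le ((div_le_one (by nlinarith)).2 ?_)
    nlinarith
  · have e : 1 / (A * B) * ((A - u) / (A - u + 1)) * (A + u)
        = (A - u) * ((A + u) / (A * B * (A - u + 1))) := by
      have : A - u + 1 ≠ 0 := by linarith
      field_simp
    rw [e]
    refine mul_le_of_le_one_right hd.le ((div_le_one (by nlinarith)).2 ?_)
    nlinarith
  · have e : 1 / (A * B) * ((A - u) / (A - u + 1)) * (1 / u) * (A + u)
        = (A - u) * ((A + u) / (A * B * (A - u + 1) * u)) := by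
      have : A - u + 1 ≠ 0 := by linarith
      field_simp
    rw [e]
    rw [div_le_iff₀ hAB0] at h
    refine mul_le_of_le_one_right hd.le ((div_le_one (by positivity)).2 ?_)
    have h1 : A * B * (A - u + 1) * u - (A + u)
        = (A - u) * (u * (A * B) - 1) + u * (A * B - 2) := by ring
    nlinarith [mul_nonneg hd.le (sub_nonneg.2 h),
      mul_nonneg hu0.le (show 0 ≤ A * B - 2 by linarith)]

/-- lower bound for the second Bohr radius of pluriharmonic functions on the
unit ball of the Minkowski space `ℓⁿ_q`. -/
theorem second_bohr_PH_lower_bound_lq {n : ℕ} (hn : 1 ≤ n)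
    {H : Type*} [NormedAddCommGroup H] [InnerProductSpace ℂ H] [CompleteSpace H]
    {Y : Type*} [NormedAddCommGroup Y] [NormedSpace ℂ Y] [CompleteSpace Y]
    (U : (H →L[ℂ] H) →L[ℂ] Y) (p lam : ℝ) (q : ℝ≥0∞)
    (hp : 1 ≤ p) (hq : 1 ≤ q) (hlam : 1 < lam)
    (hU0 : U ≠ 0) (hU : ‖U‖ < lam)
    (D : ℝ)
    (hD : D = if 1 / (4 * lam * (2 : ℝ) ^ (1 / p)) ≤ ‖U‖ then
        max ((1 / (4 * lam * (2 : ℝ) ^ (1 / p))) *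
              ((lam ^ p - ‖U‖ ^ p) / (2 * lam ^ p - ‖U‖ ^ p)) ^ (1 / p))
          ((1 / (4 * lam * (2 : ℝ) ^ (1 / p))) *
              ((lam ^ p - ‖U‖ ^ p) / (lam ^ p - ‖U‖ ^ p + 1)) ^ (1 / p) * (1 / ‖U‖))
      else
        max ((1 / (4 * lam * (2 : ℝ) ^ (1 / p))) *
              ((lam ^ p - ‖U‖ ^ p) / (2 * lam ^ p - ‖U‖ ^ p)) ^ (1 / p))
          ((1 / (4 * lam * (2 : ℝ) ^ (1 / p))) *
              ((lam ^ p - ‖U‖ ^ p) / (lam ^ p - ‖U‖ ^ p + 1)) ^ (1 / p)))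
    :
    D * (n : ℝ) ^ (-(1 / p + (1 / q).toReal)) ≤ secondBohrPH (lqBall n q) p lam U := by
  have hp0 : 0 < p := by linarith
  have hn' : (0 : ℝ) < n := by exact_mod_cast hn
  have hl0 : 0 < lam := by linarith
  have hu : 0 < ‖U‖ := norm_pos_iff.2 hU0
  have hA1 : 1 ≤ lam ^ p := Real.one_le_rpow hlam.le hp0.le
  have hu0 : 0 < ‖U‖ ^ p := Real.rpow_pos_of_pos hu p
  have huA : ‖U‖ ^ p < lam ^ p := Real.rpow_lt_rpow hu.le hU hp0
  have hB : (2 : ℝ) ≤ 4 ^ p * 2 := by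
    have : (1 : ℝ) ≤ 4 ^ p := Real.one_le_rpow (by norm_num) hp0.le
    linarith
  have hroot : ∀ x : ℝ, 0 ≤ x → (x ^ (1 / p)) ^ p = x := fun x hx => by
    rw [one_div, Real.rpow_inv_rpow hx hp0.ne']
  set κ := 1 / (4 * lam * (2 : ℝ) ^ (1 / p)) with hκ
  have hκ0 : 0 ≤ κ := by positivity
  have hκp : κ ^ p = 1 / (lam ^ p * (4 ^ p * 2)) := by
    rw [hκ, Real.div_rpow zero_le_one (by positivity), Real.one_rpow,
      Real.mul_rpow (by positivity) (by positivity), Real.mul_rpow (by norm_num) hl0.le,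
      hroot 2 (by norm_num)]
    ring
  have hw1 : 0 ≤ (lam ^ p - ‖U‖ ^ p) / (2 * lam ^ p - ‖U‖ ^ p) :=
    div_nonneg (by linarith) (by linarith)
  have hw2 : 0 ≤ (lam ^ p - ‖U‖ ^ p) / (lam ^ p - ‖U‖ ^ p + 1) :=
    div_nonneg (by linarith) (by linarith)
  obtain ⟨est1, est2, est3⟩ := bohr_const_estimates hA1 hu0 huA hB
  have hDkey : 0 ≤ D ∧ D ^ p * (lam ^ p + ‖U‖ ^ p) ≤ lam ^ p - ‖U‖ ^ p := by
    have c1 : (κ * ((lam ^ p - ‖U‖ ^ p) / (2 * lam ^ p - ‖U‖ ^ p)) ^ (1 / p)) ^ p *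
        (lam ^ p + ‖U‖ ^ p) ≤ lam ^ p - ‖U‖ ^ p := by
      rw [Real.mul_rpow hκ0 (by positivity), hroot _ hw1, hκp]
      exact est1
    rw [hD]
    split_ifs with hcase
    · refine ⟨le_max_of_le_left (by positivity), ?_⟩
      refine max_rec' (fun x => x ^ p * (lam ^ p + ‖U‖ ^ p) ≤ lam ^ p - ‖U‖ ^ p) c1 ?_
      rw [Real.mul_rpow (by positivity) (by positivity), Real.mul_rpow hκ0 (by positivity),
        hroot _ hw2, hκp, Real.div_rpow zero_le_one hu.le, Real.one_rpow]
      refine est3 ?_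
      rw [← hκp]
      exact Real.rpow_le_rpow hκ0 hcase hp0.le
    · refine ⟨le_max_of_le_left (by positivity), ?_⟩
      refine max_rec' (fun x => x ^ p * (lam ^ p + ‖U‖ ^ p) ≤ lam ^ p - ‖U‖ ^ p) c1 ?_
      rw [Real.mul_rpow hκ0 (by positivity), hroot _ hw2, hκp]
      exact est2
  obtain ⟨hD0, hDp⟩ := hDkey
  refine le_secondBohrPH hn U (fun z hz t => rotate_mem_lqBall hz t) hp hl0.le hU0
    (by positivity) (le_trans ?_ hDp)
  refine mul_le_mul_of_nonneg_right ?_ (by positivity)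
  rw [Real.mul_rpow hD0 (by positivity), mul_left_comm]
  refine mul_le_of_le_one_right (by positivity) ?_
  rw [← Real.rpow_mul hn'.le]
  calc (n : ℝ) * (n : ℝ) ^ (-(1 / p + (1 / q).toReal) * p)
      = (n : ℝ) ^ (1 + -(1 / p + (1 / q).toReal) * p) := by
        rw [Real.rpow_add hn', Real.rpow_one]
    _ ≤ 1 := by
        refine Real.rpow_le_one_of_one_le_of_nonpos (by exact_mod_cast hn) ?_
        have : 1 + -(1 / p + (1 / q).toReal) * p = -((1 / q).toReal * p) := by
          field_simp; ring
        rw [this]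
        exact neg_nonpos.2 (mul_nonneg ENNReal.toReal_nonneg hp0.le)

end BohrPaper
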